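/- Let W be a regular multiplicative unitary on a complex Hilbert space H and Ŵ := ΣW*Σ. Then [(a ⊗ 1)·W·(1 ⊗ b) : a ∈ Â(W), b ∈ Â(Ŵ)] = Â(W) ⊗min Â(Ŵ). -/

import Mathlib

/-!
Common framework: we axiomatize realizations of Hilbert-space tensor products.
A `TensorPair E F EF` realizes the Hilbert tensor product `E ⊗ F` as the Hilbert
space `EF`: it consists of a bilinear map `(a, b) ↦ a ⊗ b` whose image satisfies
the characteristic inner-product identity and has total (dense) linear span.
Operators such as the leg operators `X₁₂`, `X₂₃`, `X₁₃`, amplifications `a ⊗ b`,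
and the tensor flip `Σ` are then uniquely characterized by their matrix
coefficients against elementary tensors.
-/

noncomputable section

open scoped InnerProductSpace
open ContinuousLinearMap

/-- A realization of the Hilbert tensor product `E ⊗ F` as the Hilbert space `EF`. -/
structure TensorPair (E F EF : Type*)
    [NormedAddCommGroup E] [InnerProductSpace ℂ E]
    [NormedAddCommGroup F] [InnerProductSpace ℂ F]
    [NormedAddCommGroup EF] [InnerProductSpace ℂ EF] where
  tmul : E →ₗ[ℂ] F →ₗ[ℂ] EF
  inner_tmul : ∀ (a c : E) (b d : F), ⟪tmul a b, tmul c d⟫_ℂ = ⟪a, c⟫_ℂ * ⟪b, d⟫_ℂ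
  dense_span : Dense (Submodule.span ℂ {z : EF | ∃ a b, z = tmul a b} : Set EF)

/-- A realization of the threefold Hilbert tensor product `E ⊗ F ⊗ G` as `EFG`. -/
structure TensorTriple (E F G EFG : Type*)
    [NormedAddCommGroup E] [InnerProductSpace ℂ E]
    [NormedAddCommGroup F] [InnerProductSpace ℂ F]
    [NormedAddCommGroup G] [InnerProductSpace ℂ G]
    [NormedAddCommGroup EFG] [InnerProductSpace ℂ EFG] where
  tmul : E →ₗ[ℂ] F →ₗ[ℂ] G →ₗ[ℂ] EFG
  inner_tmul : ∀ (a a' : E) (b b' : F) (c c' : G),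
    ⟪tmul a b c, tmul a' b' c'⟫_ℂ = ⟪a, a'⟫_ℂ * ⟪b, b'⟫_ℂ * ⟪c, c'⟫_ℂ
  dense_span : Dense (Submodule.span ℂ {z : EFG | ∃ a b c, z = tmul a b c} : Set EFG)

/-- The norm-closed linear span `[S]` of a set of vectors/operators. -/
def cspan {V : Type*} [NormedAddCommGroup V] [NormedSpace ℂ V] (S : Set V) : Set V :=
  closure (Submodule.span ℂ S : Set V)

/-- The set of right-leg slices `(id ⊗ ω_{ξ,η})(X)` of an operator
`X : M₁ ⊗ K₁ → M₂ ⊗ K₂`, i.e. all operators `T : M₁ → M₂` such that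
`⟪ζ, T ζ'⟫ = ⟪ζ ⊗ ξ, X (ζ' ⊗ η)⟫` for some `ξ ∈ K₂`, `η ∈ K₁`. -/
def slicesR {M₁ K₁ M₂ K₂ Ha Hb : Type*}
    [NormedAddCommGroup M₁] [InnerProductSpace ℂ M₁]
    [NormedAddCommGroup K₁] [InnerProductSpace ℂ K₁]
    [NormedAddCommGroup M₂] [InnerProductSpace ℂ M₂]
    [NormedAddCommGroup K₂] [InnerProductSpace ℂ K₂]
    [NormedAddCommGroup Ha] [InnerProductSpace ℂ Ha]
    [NormedAddCommGroup Hb] [InnerProductSpace ℂ Hb]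
    (ta : TensorPair M₁ K₁ Ha) (tb : TensorPair M₂ K₂ Hb)
    (X : Ha →L[ℂ] Hb) : Set (M₁ →L[ℂ] M₂) :=
  {T | ∃ (ξ : K₂) (η : K₁), ∀ (ζ : M₂) (ζ' : M₁),
    ⟪ζ, T ζ'⟫_ℂ = ⟪tb.tmul ζ ξ, X (ta.tmul ζ' η)⟫_ℂ}

/-- The set of left-leg slices `(ω_{ξ,η} ⊗ id)(X)` of an operator
`X : K₁ ⊗ M₁ → K₂ ⊗ M₂`, i.e. all operators `T : M₁ → M₂` such that
`⟪ζ, T ζ'⟫ = ⟪ξ ⊗ ζ, X (η ⊗ ζ')⟫` for some `ξ ∈ K₂`, `η ∈ K₁`. -/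
def slicesL {M₁ K₁ M₂ K₂ Ha Hb : Type*}
    [NormedAddCommGroup M₁] [InnerProductSpace ℂ M₁]
    [NormedAddCommGroup K₁] [InnerProductSpace ℂ K₁]
    [NormedAddCommGroup M₂] [InnerProductSpace ℂ M₂]
    [NormedAddCommGroup K₂] [InnerProductSpace ℂ K₂]
    [NormedAddCommGroup Ha] [InnerProductSpace ℂ Ha]
    [NormedAddCommGroup Hb] [InnerProductSpace ℂ Hb]
    (ta : TensorPair K₁ M₁ Ha) (tb : TensorPair K₂ M₂ Hb)
    (X : Ha →L[ℂ] Hb) : Set (M₁ →L[ℂ] M₂) :=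
  {T | ∃ (ξ : K₂) (η : K₁), ∀ (ζ : M₂) (ζ' : M₁),
    ⟪ζ, T ζ'⟫_ℂ = ⟪tb.tmul ξ ζ, X (ta.tmul η ζ')⟫_ℂ}

/-- `Â(X) := [(id ⊗ ω_{ξ,η})(X) : ξ, η ∈ H] ⊆ B(H)` for `X ∈ B(H ⊗ H)`. -/
def hatA {H H2 : Type*}
    [NormedAddCommGroup H] [InnerProductSpace ℂ H]
    [NormedAddCommGroup H2] [InnerProductSpace ℂ H2]
    (t2 : TensorPair H H H2) (X : H2 →L[ℂ] H2) : Set (H →L[ℂ] H) :=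
  cspan (slicesR t2 t2 X)

/-- `A(X) := [(ω_{ξ,η} ⊗ id)(X) : ξ, η ∈ H] ⊆ B(H)` for `X ∈ B(H ⊗ H)`. -/
def legA {H H2 : Type*}
    [NormedAddCommGroup H] [InnerProductSpace ℂ H]
    [NormedAddCommGroup H2] [InnerProductSpace ℂ H2]
    (t2 : TensorPair H H H2) (X : H2 →L[ℂ] H2) : Set (H →L[ℂ] H) :=
  cspan (slicesL t2 t2 X)

/-- `T` is the tensor-product operator `a ⊗ b : E ⊗ F → E' ⊗ F'`, characterized by its
matrix coefficients against elementary tensors.  In particular `IsTensorOp ta tb a 1 T`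
says that `T = a ⊗ 1`, and `IsTensorOp ta tb 1 b T` that `T = 1 ⊗ b`. -/
def IsTensorOp {E F EF E' F' EF' : Type*}
    [NormedAddCommGroup E] [InnerProductSpace ℂ E]
    [NormedAddCommGroup F] [InnerProductSpace ℂ F]
    [NormedAddCommGroup EF] [InnerProductSpace ℂ EF]
    [NormedAddCommGroup E'] [InnerProductSpace ℂ E']
    [NormedAddCommGroup F'] [InnerProductSpace ℂ F']
    [NormedAddCommGroup EF'] [InnerProductSpace ℂ EF']
    (ta : TensorPair E F EF) (tb : TensorPair E' F' EF')
    (a : E →L[ℂ] E') (b : F →L[ℂ] F') (T : EF →L[ℂ] EF') : Prop :=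
  ∀ (ζ : E') (ξ : F') (ζ' : E) (η : F),
    ⟪tb.tmul ζ ξ, T (ta.tmul ζ' η)⟫_ℂ = ⟪ζ, a ζ'⟫_ℂ * ⟪ξ, b η⟫_ℂ

/-- `A ⊗min B := [(a ⊗ 1)(1 ⊗ b) : a ∈ A, b ∈ B] = [a ⊗ b : a ∈ A, b ∈ B]`. -/
def minTensor {E F EF : Type*}
    [NormedAddCommGroup E] [InnerProductSpace ℂ E]
    [NormedAddCommGroup F] [InnerProductSpace ℂ F]
    [NormedAddCommGroup EF] [InnerProductSpace ℂ EF]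
    (t : TensorPair E F EF)
    (A : Set (E →L[ℂ] E)) (B : Set (F →L[ℂ] F)) : Set (EF →L[ℂ] EF) :=
  cspan {T | ∃ a ∈ A, ∃ b ∈ B, IsTensorOp t t a b T}

/-- `Y = X₁₂ = X ⊗ 1` on `E ⊗ F ⊗ G`, for `X ∈ B(E ⊗ F)`. -/
def IsLeg12 {E F G EF EFG : Type*}
    [NormedAddCommGroup E] [InnerProductSpace ℂ E]
    [NormedAddCommGroup F] [InnerProductSpace ℂ F]
    [NormedAddCommGroup G] [InnerProductSpace ℂ G]
    [NormedAddCommGroup EF] [InnerProductSpace ℂ EF]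
    [NormedAddCommGroup EFG] [InnerProductSpace ℂ EFG]
    (t2 : TensorPair E F EF) (t3 : TensorTriple E F G EFG)
    (X : EF →L[ℂ] EF) (Y : EFG →L[ℂ] EFG) : Prop :=
  ∀ (a a' : E) (b b' : F) (c c' : G),
    ⟪t3.tmul a b c, Y (t3.tmul a' b' c')⟫_ℂ
      = ⟪t2.tmul a b, X (t2.tmul a' b')⟫_ℂ * ⟪c, c'⟫_ℂ

/-- `Y = X₂₃ = 1 ⊗ X` on `E ⊗ F ⊗ G`, for `X ∈ B(F ⊗ G)`. -/
def IsLeg23 {E F G FG EFG : Type*}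
    [NormedAddCommGroup E] [InnerProductSpace ℂ E]
    [NormedAddCommGroup F] [InnerProductSpace ℂ F]
    [NormedAddCommGroup G] [InnerProductSpace ℂ G]
    [NormedAddCommGroup FG] [InnerProductSpace ℂ FG]
    [NormedAddCommGroup EFG] [InnerProductSpace ℂ EFG]
    (t2 : TensorPair F G FG) (t3 : TensorTriple E F G EFG)
    (X : FG →L[ℂ] FG) (Y : EFG →L[ℂ] EFG) : Prop :=
  ∀ (a a' : E) (b b' : F) (c c' : G),
    ⟪t3.tmul a b c, Y (t3.tmul a' b' c')⟫_ℂ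
      = ⟪t2.tmul b c, X (t2.tmul b' c')⟫_ℂ * ⟪a, a'⟫_ℂ

/-- `Y = X₁₃ = Σ₁₂X₂₃Σ₁₂` on `E ⊗ F ⊗ G`, for `X ∈ B(E ⊗ G)`: `X` acting on the
first and third legs. -/
def IsLeg13 {E F G EG EFG : Type*}
    [NormedAddCommGroup E] [InnerProductSpace ℂ E]
    [NormedAddCommGroup F] [InnerProductSpace ℂ F]
    [NormedAddCommGroup G] [InnerProductSpace ℂ G]
    [NormedAddCommGroup EG] [InnerProductSpace ℂ EG]
    [NormedAddCommGroup EFG] [InnerProductSpace ℂ EFG]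
    (t2 : TensorPair E G EG) (t3 : TensorTriple E F G EFG)
    (X : EG →L[ℂ] EG) (Y : EFG →L[ℂ] EFG) : Prop :=
  ∀ (a a' : E) (b b' : F) (c c' : G),
    ⟪t3.tmul a b c, Y (t3.tmul a' b' c')⟫_ℂ
      = ⟪t2.tmul a c, X (t2.tmul a' c')⟫_ℂ * ⟪b, b'⟫_ℂ

section Part1

set_option linter.unusedSectionVars false

open scoped TensorProduct

namespace TensorPair

variable {E F EF G F' EF' F'' EF'' : Type*}
    [NormedAddCommGroup E] [InnerProductSpace ℂ E]
    [NormedAddCommGroup F] [InnerProductSpace ℂ F]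
    [NormedAddCommGroup EF] [InnerProductSpace ℂ EF]
    [NormedAddCommGroup G] [InnerProductSpace ℂ G]
    [NormedAddCommGroup F'] [InnerProductSpace ℂ F']
    [NormedAddCommGroup EF'] [InnerProductSpace ℂ EF']
    [NormedAddCommGroup F''] [InnerProductSpace ℂ F'']
    [NormedAddCommGroup EF''] [InnerProductSpace ℂ EF'']

/-- Swap the two factors. -/
def flip (t : TensorPair E F EF) : TensorPair F E EF where
  tmul := t.tmul.flip
  inner_tmul a c b d := by simp [t.inner_tmul, mul_comm]
  dense_span := by
    convert t.dense_span using 4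
    ext z
    constructor
    · rintro ⟨a, b, h⟩; exact ⟨b, a, h⟩
    · rintro ⟨a, b, h⟩; exact ⟨b, a, h⟩

@[simp] lemma flip_tmul (t : TensorPair E F EF) (a : E) (b : F) :
    t.flip.tmul b a = t.tmul a b := rfl

/-- A scaled isometry out of the algebraic tensor product. -/
lemma inner_lift (f : E →ₗ[ℂ] F →ₗ[ℂ] G) (k : ℂ)
    (hf : ∀ a b c d, ⟪f a b, f c d⟫_ℂ = k * (⟪a, c⟫_ℂ * ⟪b, d⟫_ℂ)) (z w : E ⊗[ℂ] F) :
    ⟪TensorProduct.lift f z, TensorProduct.lift f w⟫_ℂ = k * ⟪z, w⟫_ℂ := by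
  induction z with
  | zero => simp
  | add x y hx hy => simp only [map_add, inner_add_left, hx, hy, mul_add]
  | tmul a b =>
    induction w with
    | zero => simp
    | add x y hx hy => simp only [map_add, inner_add_right, hx, hy, mul_add]
    | tmul c d => simp [hf]

/-- The canonical map from the algebraic tensor product. -/
def alg (t : TensorPair E F EF) : E ⊗[ℂ] F →ₗ[ℂ] EF := TensorProduct.lift t.tmul

@[simp] lemma alg_tmul (t : TensorPair E F EF) (a : E) (b : F) :
    t.alg (a ⊗ₜ b) = t.tmul a b := by simp [alg]

lemma inner_alg (t : TensorPair E F EF) (z w : E ⊗[ℂ] F) : ⟪t.alg z, t.alg w⟫_ℂ = ⟪z, w⟫_ℂ := by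
  have := inner_lift t.tmul 1 (fun a b c d => by simp [t.inner_tmul]) z w
  simpa [alg] using this

lemma norm_alg (t : TensorPair E F EF) (z : E ⊗[ℂ] F) : ‖t.alg z‖ = ‖z‖ := by
  rw [@norm_eq_sqrt_re_inner ℂ, @norm_eq_sqrt_re_inner ℂ, inner_alg]

lemma dense_alg (t : TensorPair E F EF) : DenseRange t.alg := by
  refine t.dense_span.mono ?_
  have : Submodule.span ℂ {z : EF | ∃ a b, z = t.tmul a b} ≤ LinearMap.range t.alg := by
    rw [Submodule.span_le]
    rintro _ ⟨a, b, rfl⟩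
    exact ⟨a ⊗ₜ b, by simp⟩
  exact this

lemma ext_clm (t : TensorPair E F EF) {G : Type*} [NormedAddCommGroup G] [NormedSpace ℂ G]
    {S T : EF →L[ℂ] G} (h : ∀ a b, S (t.tmul a b) = T (t.tmul a b)) : S = T := by
  have : (S : EF → G) = T := by
    refine t.dense_alg.equalizer S.continuous T.continuous ?_
    funext z
    induction z with
    | zero => simp
    | add x y hx hy => simp only [Function.comp_apply, map_add] at *; rw [hx, hy]
    | tmul a b => simpa using h a b
  exact DFunLike.coe_injective this

lemma ext_vec (t : TensorPair E F EF) {x y : EF}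
    (h : ∀ a b, ⟪t.tmul a b, x⟫_ℂ = ⟪t.tmul a b, y⟫_ℂ) : x = y := by
  have : innerSL ℂ x = innerSL ℂ y := by
    apply t.ext_clm
    intro a b
    simp only [innerSL_apply_apply]
    rw [← inner_conj_symm, h, inner_conj_symm]
  exact innerSL_inj.mp this

lemma norm_tmul (t : TensorPair E F EF) (a : E) (b : F) : ‖t.tmul a b‖ = ‖a‖ * ‖b‖ := by
  rw [← alg_tmul, norm_alg, TensorProduct.norm_tmul]

/-- `l ξ : x ↦ ξ ⊗ x`, continuous linear in `ξ`. -/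
def l (t : TensorPair E F EF) : E →L[ℂ] F →L[ℂ] EF :=
  t.tmul.mkContinuous₂ 1 fun a b => by simp [norm_tmul]

@[simp] lemma l_apply (t : TensorPair E F EF) (a : E) (b : F) : t.l a b = t.tmul a b := rfl

lemma amp_bound (t : TensorPair E F EF) (t' : TensorPair E F' EF') (b : F →L[ℂ] F')
    (z : E ⊗[ℂ] F) : ‖(t'.alg ∘ₗ (b.lTensor E).toLinearMap) z‖ ≤ ‖b‖ * ‖t.alg z‖ := by
  simp only [LinearMap.comp_apply, norm_alg]
  exact (le_opNorm (b.lTensor E) z).trans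
    (mul_le_mul_of_nonneg_right (norm_lTensor_le _ b) (norm_nonneg _))

/-- The amplification `1 ⊗ b`. -/
def amp0 [CompleteSpace EF'] (t : TensorPair E F EF) (t' : TensorPair E F' EF') (b : F →L[ℂ] F') :
    EF →L[ℂ] EF' :=
  (t'.alg ∘ₗ (b.lTensor E).toLinearMap).extendOfNorm t.alg

lemma amp0_tmul [CompleteSpace EF'] (t : TensorPair E F EF) (t' : TensorPair E F' EF')
    (b : F →L[ℂ] F') (x : E) (y : F) : amp0 t t' b (t.tmul x y) = t'.tmul x (b y) := by
  rw [← alg_tmul, amp0, LinearMap.extendOfNorm_eq t.dense_alg ⟨_, amp_bound t t' b⟩]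
  simp

/-- The amplification `b ↦ 1 ⊗ b` as a continuous linear map. -/
def amp [CompleteSpace EF'] (t : TensorPair E F EF) (t' : TensorPair E F' EF') :
    (F →L[ℂ] F') →L[ℂ] (EF →L[ℂ] EF') :=
  LinearMap.mkContinuous
    { toFun := amp0 t t'
      map_add' := fun a b => t.ext_clm fun x y => by simp [amp0_tmul]
      map_smul' := fun a b => t.ext_clm fun x y => by simp [amp0_tmul] } 1 (fun b => by
    rw [one_mul]
    exact LinearMap.opNorm_extendOfNorm_le t.dense_alg (norm_nonneg _) (amp_bound t t' b))

@[simp] lemma amp_tmul [CompleteSpace EF'] (t : TensorPair E F EF) (t' : TensorPair E F' EF')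
    (b : F →L[ℂ] F') (x : E) (y : F) : amp t t' b (t.tmul x y) = t'.tmul x (b y) :=
  amp0_tmul t t' b x y

lemma amp_comp [CompleteSpace EF'] [CompleteSpace EF''] (t : TensorPair E F EF)
    (t' : TensorPair E F' EF') (t'' : TensorPair E F'' EF'') (b : F →L[ℂ] F')
    (c : F' →L[ℂ] F'') : amp t t'' (c ∘L b) = amp t' t'' c ∘L amp t t' b :=
  t.ext_clm fun x y => by simp

lemma amp_adjoint [CompleteSpace EF'] [CompleteSpace EF] [CompleteSpace F] [CompleteSpace F']
    (t : TensorPair E F EF) (t' : TensorPair E F' EF') (b : F →L[ℂ] F') :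
    adjoint (amp t t' b) = amp t' t (adjoint b) := by
  apply t'.ext_clm
  intro x y
  apply t.ext_vec
  intro u v
  simp [adjoint_inner_right, t.inner_tmul, t'.inner_tmul]

/-- Lift of a bilinear map which is isometric up to a scalar. -/
def liftK [CompleteSpace G] (t : TensorPair E F EF) (f : E →ₗ[ℂ] F →ₗ[ℂ] G) : EF →L[ℂ] G :=
  (TensorProduct.lift f).extendOfNorm t.alg

lemma liftK_tmul [CompleteSpace G] (t : TensorPair E F EF) (f : E →ₗ[ℂ] F →ₗ[ℂ] G) (k : ℂ)
    (hf : ∀ a b c d, ⟪f a b, f c d⟫_ℂ = k * (⟪a, c⟫_ℂ * ⟪b, d⟫_ℂ)) (a : E) (b : F) :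
    liftK t f (t.tmul a b) = f a b := by
  rw [← alg_tmul, liftK, LinearMap.extendOfNorm_eq t.dense_alg]
  · simp
  · refine ⟨Real.sqrt ‖k‖, fun z => ?_⟩
    rw [norm_alg]
    apply (sq_le_sq₀ (norm_nonneg _) (by positivity)).mp
    rw [mul_pow, Real.sq_sqrt (norm_nonneg _)]
    have h := congrArg norm (inner_lift f k hf z z)
    rw [norm_mul, inner_self_eq_norm_sq_to_K (𝕜 := ℂ) z,
      inner_self_eq_norm_sq_to_K (𝕜 := ℂ)] at h
    simpa using h.le

end TensorPair

namespace TensorTriple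

variable {E F G EF FG EFG : Type*}
    [NormedAddCommGroup E] [InnerProductSpace ℂ E]
    [NormedAddCommGroup F] [InnerProductSpace ℂ F]
    [NormedAddCommGroup G] [InnerProductSpace ℂ G]
    [NormedAddCommGroup EF] [InnerProductSpace ℂ EF]
    [NormedAddCommGroup FG] [InnerProductSpace ℂ FG]
    [NormedAddCommGroup EFG] [InnerProductSpace ℂ EFG] [CompleteSpace EFG]

lemma lift_tmul (t3 : TensorTriple E F G EFG) (t2 : TensorPair F G FG) (a : E) (b : F) (c : G) :
    t2.liftK (t3.tmul a) (t2.tmul b c) = t3.tmul a b c :=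
  t2.liftK_tmul (t3.tmul a) ⟪a, a⟫_ℂ (fun _ _ _ _ => by rw [t3.inner_tmul]; ring) b c

/-- `E ⊗ (F ⊗ G)` realised on `EFG`. -/
def assocR (t3 : TensorTriple E F G EFG) (t2 : TensorPair F G FG) : TensorPair E FG EFG where
  tmul :=
    { toFun := fun a => (t2.liftK (t3.tmul a)).toLinearMap
      map_add' := fun a b => by
        rw [← ContinuousLinearMap.toLinearMap_add]
        congr 1
        exact t2.ext_clm fun x y => by
          rw [lift_tmul, add_apply, lift_tmul, lift_tmul]; simp
      map_smul' := fun a b => by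
        rw [RingHom.id_apply, ← ContinuousLinearMap.toLinearMap_smul]
        congr 1
        exact t2.ext_clm fun x y => by
          rw [lift_tmul, smul_apply, lift_tmul]; simp }
  inner_tmul a c z w := by
    simp only [LinearMap.coe_mk, AddHom.coe_mk, ContinuousLinearMap.coe_coe]
    have h1 : ∀ b d, (innerSL ℂ (t2.liftK (t3.tmul a) (t2.tmul b d))) ∘L t2.liftK (t3.tmul c) =
        ⟪a, c⟫_ℂ • innerSL ℂ (t2.tmul b d) := fun b d => t2.ext_clm fun x y => by
      simp [lift_tmul, t3.inner_tmul, t2.inner_tmul, mul_assoc]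
    have h2 : (innerSL ℂ (t2.liftK (t3.tmul c) w)) ∘L t2.liftK (t3.tmul a) =
        ⟪c, a⟫_ℂ • innerSL ℂ w := t2.ext_clm fun x y => by
      have := congrArg (fun f => (starRingEnd ℂ) (f w)) (h1 x y)
      simpa using this
    have := congrArg (fun f => (starRingEnd ℂ) (f z)) h2
    simpa using this
  dense_span := by
    refine t3.dense_span.mono (Submodule.span_mono ?_)
    rintro _ ⟨a, b, c, rfl⟩
    exact ⟨a, t2.tmul b c, (lift_tmul t3 t2 a b c).symm⟩

@[simp] lemma assocR_tmul (t3 : TensorTriple E F G EFG) (t2 : TensorPair F G FG)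
    (a : E) (b : F) (c : G) : (t3.assocR t2).tmul a (t2.tmul b c) = t3.tmul a b c :=
  lift_tmul t3 t2 a b c

/-- Rotate the factors. -/
def rot (t3 : TensorTriple E F G EFG) : TensorTriple G E F EFG where
  tmul :=
    { toFun := fun c => LinearMap.mk₂ ℂ (fun a b => t3.tmul a b c) (by simp) (by simp) (by simp)
        (by simp)
      map_add' := fun a b => by ext; simp
      map_smul' := fun a b => by ext; simp }
  inner_tmul a a' b b' c c' := by simp [t3.inner_tmul]; ring
  dense_span := by
    refine t3.dense_span.mono (Submodule.span_mono ?_)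
    rintro _ ⟨a, b, c, rfl⟩
    exact ⟨c, a, b, rfl⟩

/-- `(E ⊗ F) ⊗ G` realised on `EFG`. -/
def assocL (t3 : TensorTriple E F G EFG) (t2 : TensorPair E F EF) : TensorPair EF G EFG :=
  (t3.rot.assocR t2).flip

@[simp] lemma assocL_tmul (t3 : TensorTriple E F G EFG) (t2 : TensorPair E F EF)
    (a : E) (b : F) (c : G) : (t3.assocL t2).tmul (t2.tmul a b) c = t3.tmul a b c :=
  lift_tmul t3.rot t2 c a b

lemma ext_clm (t3 : TensorTriple E F G EFG) (t2 : TensorPair F G FG) {K : Type*}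
    [NormedAddCommGroup K] [NormedSpace ℂ K]
    {S T : EFG →L[ℂ] K} (h : ∀ a b c, S (t3.tmul a b c) = T (t3.tmul a b c)) : S = T := by
  apply (t3.assocR t2).ext_clm
  intro a z
  have : S ∘L (t3.assocR t2).l a = T ∘L (t3.assocR t2).l a :=
    t2.ext_clm fun b c => by simpa using h a b c
  exact congrArg (fun f => f z) this

lemma ext_vec (t3 : TensorTriple E F G EFG) (t2 : TensorPair F G FG) {x y : EFG}
    (h : ∀ a b c, ⟪t3.tmul a b c, x⟫_ℂ = ⟪t3.tmul a b c, y⟫_ℂ) : x = y := by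
  have : innerSL ℂ x = innerSL ℂ y := by
    apply t3.ext_clm t2
    intro a b c
    simp only [innerSL_apply_apply]
    rw [← inner_conj_symm, h, inner_conj_symm]
  exact innerSL_inj.mp this

end TensorTriple

end Part1

section Part2

set_option linter.unusedSectionVars false

/-- Closed linear span as a submodule. -/
def cl {V : Type*} [NormedAddCommGroup V] [NormedSpace ℂ V] (S : Set V) : Submodule ℂ V :=
  (Submodule.span ℂ S).topologicalClosure

lemma coe_cl {V : Type*} [NormedAddCommGroup V] [NormedSpace ℂ V] (S : Set V) :
    (cl S : Set V) = cspan S := rfl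

lemma subset_cl {V : Type*} [NormedAddCommGroup V] [NormedSpace ℂ V] (S : Set V) :
    S ⊆ cl S := fun _ h => Submodule.le_topologicalClosure _ (Submodule.subset_span h)

lemma mem_cl {V : Type*} [NormedAddCommGroup V] [NormedSpace ℂ V] {S : Set V} {x : V}
    (h : x ∈ S) : x ∈ cl S := subset_cl S h

lemma isClosed_cl {V : Type*} [NormedAddCommGroup V] [NormedSpace ℂ V] (S : Set V) :
    IsClosed (cl S : Set V) := Submodule.isClosed_topologicalClosure _

lemma cl_le {V : Type*} [NormedAddCommGroup V] [NormedSpace ℂ V] {S : Set V}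
    {P : Submodule ℂ V} (hP : IsClosed (P : Set V)) (h : S ⊆ P) : cl S ≤ P :=
  Submodule.topologicalClosure_minimal _ (Submodule.span_le.mpr h) hP

lemma cl_le_cl {V : Type*} [NormedAddCommGroup V] [NormedSpace ℂ V] {S T : Set V}
    (h : S ⊆ cl T) : cl S ≤ cl T := cl_le (isClosed_cl T) h

lemma cl_cl {V : Type*} [NormedAddCommGroup V] [NormedSpace ℂ V] (S : Set V) :
    cl (cl S : Set V) = cl S :=
  le_antisymm (cl_le_cl (subset_refl _)) (subset_cl _)

lemma mem_cl_of_map {V V' : Type*} [NormedAddCommGroup V] [NormedSpace ℂ V]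
    [NormedAddCommGroup V'] [NormedSpace ℂ V'] (f : V →L[ℂ] V') {S : Set V} {T : Set V'}
    (h : ∀ s ∈ S, f s ∈ cl T) {x : V} (hx : x ∈ cl S) : f x ∈ cl T := by
  have : cl S ≤ (cl T).comap f.toLinearMap :=
    cl_le ((isClosed_cl T).preimage f.continuous) h
  exact this hx

lemma cl_image_cl {V V' : Type*} [NormedAddCommGroup V] [NormedSpace ℂ V]
    [NormedAddCommGroup V'] [NormedSpace ℂ V'] (f : V →L[ℂ] V') (S : Set V) :
    cl (f '' (cl S : Set V)) = cl (f '' S) := by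
  apply le_antisymm
  · apply cl_le_cl
    rintro _ ⟨x, hx, rfl⟩
    exact mem_cl_of_map f (fun s hs => by exact mem_cl ⟨s, hs, rfl⟩) hx
  · apply cl_le_cl
    rintro _ ⟨x, hx, rfl⟩
    exact mem_cl ⟨x, subset_cl _ hx, rfl⟩

variable {E F G K : Type*}
    [NormedAddCommGroup E] [InnerProductSpace ℂ E]
    [NormedAddCommGroup F] [InnerProductSpace ℂ F]
    [NormedAddCommGroup G] [InnerProductSpace ℂ G]
    [NormedAddCommGroup K] [InnerProductSpace ℂ K]

/-- Products of operators. -/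
def pr (S : Set (F →L[ℂ] G)) (T : Set (E →L[ℂ] F)) : Set (E →L[ℂ] G) :=
  Set.image2 (fun s t => s ∘L t) S T

/-- Closed linear span of the products. -/
def mulM (P : Submodule ℂ (F →L[ℂ] G)) (Q : Submodule ℂ (E →L[ℂ] F)) :
    Submodule ℂ (E →L[ℂ] G) := cl (pr (P : Set (F →L[ℂ] G)) (Q : Set (E →L[ℂ] F)))

infixr:70 "⋆⋆" => mulM

lemma cl_mul_cl (S : Set (F →L[ℂ] G)) (T : Set (E →L[ℂ] F)) :
    cl S ⋆⋆ cl T = cl (pr S T) := by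
  apply le_antisymm
  · apply cl_le_cl
    rintro _ ⟨s, hs, t, ht, rfl⟩
    have h1 : ∀ s' ∈ S, s' ∘L t ∈ cl (pr S T) := fun s' hs' =>
      mem_cl_of_map (compL ℂ E F G s') (fun t' ht' => by exact mem_cl ⟨s', hs', t', ht', rfl⟩) ht
    exact mem_cl_of_map ((compL ℂ E F G).flip t) h1 hs
  · apply cl_le_cl
    rintro _ ⟨s, hs, t, ht, rfl⟩
    exact mem_cl ⟨s, subset_cl _ hs, t, subset_cl _ ht, rfl⟩

lemma mul_cl_cl (S : Set (F →L[ℂ] G)) (Q : Submodule ℂ (E →L[ℂ] F)) :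
    cl S ⋆⋆ Q = cl (pr S (Q : Set (E →L[ℂ] F))) := by
  have : cl S ⋆⋆ Q = cl S ⋆⋆ cl (Q : Set (E →L[ℂ] F)) := by
    rw [cl_mul_cl]
    apply le_antisymm
    · apply cl_le_cl
      rintro _ ⟨s, hs, t, ht, rfl⟩
      exact mem_cl_of_map ((compL ℂ E F G).flip t)
        (fun s' hs' => by exact mem_cl ⟨s', hs', t, ht, rfl⟩) hs
    · apply cl_le_cl
      rintro _ ⟨s, hs, t, ht, rfl⟩
      exact mem_cl ⟨s, subset_cl _ hs, t, ht, rfl⟩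
  rw [this, cl_mul_cl]

lemma mul_cl_right (P : Submodule ℂ (F →L[ℂ] G)) (T : Set (E →L[ℂ] F)) :
    P ⋆⋆ cl T = cl (pr (P : Set (F →L[ℂ] G)) T) := by
  rw [← cl_mul_cl]
  have : cl (P : Set (F →L[ℂ] G)) ⋆⋆ cl T = P ⋆⋆ cl T := by
    rw [mul_cl_cl]; rfl
  exact this.symm

lemma mulM_assoc (P : Submodule ℂ (G →L[ℂ] K)) (Q : Submodule ℂ (F →L[ℂ] G))
    (R : Submodule ℂ (E →L[ℂ] F)) : (P ⋆⋆ Q) ⋆⋆ R = P ⋆⋆ Q ⋆⋆ R := by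
  have h1 : (P ⋆⋆ Q) ⋆⋆ R = _ := mul_cl_cl (pr (P : Set (G →L[ℂ] K)) (Q : Set (F →L[ℂ] G))) R
  have h2 : P ⋆⋆ Q ⋆⋆ R = _ := mul_cl_right P (pr (Q : Set (F →L[ℂ] G)) (R : Set (E →L[ℂ] F)))
  rw [h1, h2]
  congr 1
  exact Set.image2_assoc fun _ _ _ => rfl

/-- The span of a single operator. -/
def sing (T : E →L[ℂ] F) : Submodule ℂ (E →L[ℂ] F) := cl {T}

lemma sing_mul_sing (S : F →L[ℂ] G) (T : E →L[ℂ] F) : sing S ⋆⋆ sing T = sing (S ∘L T) := by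
  simp [sing, cl_mul_cl, pr]

lemma sing_mul_cl (S : F →L[ℂ] G) (T : Set (E →L[ℂ] F)) :
    sing S ⋆⋆ cl T = cl ((fun t => S ∘L t) '' T) := by
  simp [sing, cl_mul_cl, pr]

lemma cl_mul_sing (S : Set (F →L[ℂ] G)) (T : E →L[ℂ] F) :
    cl S ⋆⋆ sing T = cl ((fun s => s ∘L T) '' S) := by
  simp [sing, cl_mul_cl, pr]

/-- Adjoint of a space of operators. -/
def adj [CompleteSpace E] [CompleteSpace F] (P : Submodule ℂ (E →L[ℂ] F)) :
    Submodule ℂ (F →L[ℂ] E) := P.comap (adjoint : (F →L[ℂ] E) ≃ₗᵢ⋆[ℂ] (E →L[ℂ] F)).toLinearEquiv.toLinearMap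

lemma mem_adj [CompleteSpace E] [CompleteSpace F] (P : Submodule ℂ (E →L[ℂ] F))
    (T : F →L[ℂ] E) : T ∈ adj P ↔ adjoint T ∈ P := Iff.rfl

lemma adj_adj [CompleteSpace E] [CompleteSpace F] (P : Submodule ℂ (E →L[ℂ] F)) :
    adj (adj P) = P := by
  ext T; simp [mem_adj]

lemma adj_mono [CompleteSpace E] [CompleteSpace F] {P Q : Submodule ℂ (E →L[ℂ] F)} (h : P ≤ Q) :
    adj P ≤ adj Q := fun _ hT => h hT

lemma adj_cl [CompleteSpace E] [CompleteSpace F] (S : Set (E →L[ℂ] F)) :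
    adj (cl S) = cl ((fun s => adjoint s) '' S) := by
  have key : ∀ {E F : Type _} [NormedAddCommGroup E] [InnerProductSpace ℂ E]
      [NormedAddCommGroup F] [InnerProductSpace ℂ F] [CompleteSpace E] [CompleteSpace F]
      (S : Set (E →L[ℂ] F)), cl ((fun s => adjoint s) '' S) ≤ adj (cl S) := by
    intro E F _ _ _ _ _ _ S
    apply cl_le
    · exact (isClosed_cl S).preimage (adjoint : (F →L[ℂ] E) ≃ₗᵢ⋆[ℂ] (E →L[ℂ] F)).continuous
    · rintro _ ⟨s, hs, rfl⟩
      change _ ∈ adj _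
      rw [mem_adj, adjoint_adjoint]
      exact subset_cl _ hs
  apply le_antisymm _ (key S)
  rw [← adj_adj (cl ((fun s => adjoint s) '' S))]
  apply adj_mono
  apply cl_le
  · exact (isClosed_cl _).preimage (adjoint : (E →L[ℂ] F) ≃ₗᵢ⋆[ℂ] (F →L[ℂ] E)).continuous
  · intro s hs
    change _ ∈ adj _
    rw [mem_adj]
    exact mem_cl ⟨s, hs, rfl⟩

lemma adj_mul [CompleteSpace E] [CompleteSpace F] [CompleteSpace G]
    (P : Submodule ℂ (F →L[ℂ] G)) (Q : Submodule ℂ (E →L[ℂ] F)) :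
    adj (P ⋆⋆ Q) = adj Q ⋆⋆ adj P := by
  rw [mulM, mulM, adj_cl]
  congr 1
  ext T
  constructor
  · rintro ⟨_, ⟨s, hs, t, ht, rfl⟩, rfl⟩
    refine ⟨adjoint t, ?_, adjoint s, ?_, ?_⟩
    · change _ ∈ adj _; rw [mem_adj, adjoint_adjoint]; exact ht
    · change _ ∈ adj _; rw [mem_adj, adjoint_adjoint]; exact hs
    · simp [adjoint_comp]
  · rintro ⟨t, ht, s, hs, rfl⟩
    exact ⟨_, ⟨adjoint s, hs, adjoint t, ht, rfl⟩, by simp [adjoint_comp]⟩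

lemma adj_sing [CompleteSpace E] [CompleteSpace F] (T : E →L[ℂ] F) :
    adj (sing T) = sing (adjoint T) := by simp [sing, adj_cl]

/-- Closed image under a continuous linear map. -/
def mapM {V V' : Type*} [NormedAddCommGroup V] [NormedSpace ℂ V]
    [NormedAddCommGroup V'] [NormedSpace ℂ V'] (f : V →L[ℂ] V') (P : Submodule ℂ V) :
    Submodule ℂ V' := cl (f '' (P : Set V))

lemma mapM_cl {V V' : Type*} [NormedAddCommGroup V] [NormedSpace ℂ V]
    [NormedAddCommGroup V'] [NormedSpace ℂ V'] (f : V →L[ℂ] V') (S : Set V) :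
    mapM f (cl S) = cl (f '' S) := cl_image_cl f S

lemma mapM_sing {E' F' : Type*} [NormedAddCommGroup E'] [InnerProductSpace ℂ E']
    [NormedAddCommGroup F'] [InnerProductSpace ℂ F']
    (f : (E →L[ℂ] F) →L[ℂ] (E' →L[ℂ] F')) (T : E →L[ℂ] F) : mapM f (sing T) = sing (f T) := by
  simp [sing, mapM_cl]

lemma mapM_mul {E' F' G' : Type*} [NormedAddCommGroup E'] [InnerProductSpace ℂ E']
    [NormedAddCommGroup F'] [InnerProductSpace ℂ F']
    [NormedAddCommGroup G'] [InnerProductSpace ℂ G']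
    (f : (E →L[ℂ] F) →L[ℂ] (E' →L[ℂ] F')) (g : (F →L[ℂ] G) →L[ℂ] (F' →L[ℂ] G'))
    (h : (E →L[ℂ] G) →L[ℂ] (E' →L[ℂ] G')) (H : ∀ s t, h (s ∘L t) = g s ∘L f t)
    (P : Submodule ℂ (F →L[ℂ] G)) (Q : Submodule ℂ (E →L[ℂ] F)) :
    mapM h (P ⋆⋆ Q) = mapM g P ⋆⋆ mapM f Q := by
  have h1 : mapM h (P ⋆⋆ Q) = cl (h '' pr (P : Set (F →L[ℂ] G)) (Q : Set (E →L[ℂ] F))) :=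
    mapM_cl _ _
  rw [h1, mapM, mapM, cl_mul_cl]
  congr 1
  exact Set.image_image2_distrib H

lemma ra {E' : Type*} [NormedAddCommGroup E'] [InnerProductSpace ℂ E']
    {L L' : Type*} [NormedAddCommGroup L] [InnerProductSpace ℂ L]
    [NormedAddCommGroup L'] [InnerProductSpace ℂ L']
    {P : Submodule ℂ (L →L[ℂ] G)} {Q : Submodule ℂ (F →L[ℂ] L)}
    {P' : Submodule ℂ (L' →L[ℂ] G)} {Q' : Submodule ℂ (F →L[ℂ] L')}
    (h : P ⋆⋆ Q = P' ⋆⋆ Q') (X : Submodule ℂ (E' →L[ℂ] F)) :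
    P ⋆⋆ Q ⋆⋆ X = P' ⋆⋆ Q' ⋆⋆ X := by
  rw [← mulM_assoc, h, mulM_assoc]

/-- Finite rank operators are dense in the compact operators of a Hilbert space. -/
lemma compact_mem_cl [CompleteSpace E] [CompleteSpace F] (T : E →L[ℂ] F)
    (hT : IsCompactOperator T) :
    T ∈ cl (Set.range fun p : F × E => InnerProductSpace.rankOne ℂ p.1 p.2) := by
  set S := Set.range fun p : F × E => InnerProductSpace.rankOne ℂ p.1 p.2
  change T ∈ closure (Submodule.span ℂ S : Set (E →L[ℂ] F))
  rw [Metric.mem_closure_iff]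
  intro ε hε
  have hc : IsCompact (closure (T '' Metric.closedBall 0 1)) :=
    hT.isCompact_closure_image_closedBall 1
  have htb : TotallyBounded (T '' Metric.closedBall 0 1) :=
    hc.totallyBounded.subset subset_closure
  obtain ⟨s, hs, hcov⟩ := Metric.totallyBounded_iff.mp htb (ε / 2) (half_pos hε)
  have : FiniteDimensional ℂ (Submodule.span ℂ s) := FiniteDimensional.span_of_finite ℂ hs
  set U := Submodule.span ℂ s
  let b := stdOrthonormalBasis ℂ U
  have hP : U.starProjection ∘L T ∈ Submodule.span ℂ S := by
    have : U.starProjection ∘L T =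
        ∑ i, InnerProductSpace.rankOne ℂ (b i : F) (adjoint T (b i : F)) := by
      ext x
      simp only [coe_comp, Function.comp_apply, sum_apply, InnerProductSpace.rankOne_apply,
        adjoint_inner_left]
      rw [Submodule.starProjection_apply, b.orthogonalProjectionOnto_apply_eq_sum]
      simp
    rw [this]
    exact Submodule.sum_mem _ fun i _ => Submodule.subset_span ⟨(_, _), rfl⟩
  refine ⟨_, hP, ?_⟩
  rw [dist_eq_norm]
  refine lt_of_le_of_lt ?_ (half_lt_self hε)
  refine ContinuousLinearMap.opNorm_le_of_unit_norm (half_pos hε).le fun x hx => ?_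
  have hx' : T x ∈ T '' Metric.closedBall 0 1 := ⟨x, by simp [hx], rfl⟩
  obtain ⟨y, hy, hxy⟩ := Set.mem_iUnion₂.mp (hcov hx')
  rw [Metric.mem_ball, dist_eq_norm] at hxy
  have h1 := U.starProjection_minimal (T x)
  have h2 : ‖T x - U.starProjection (T x)‖ ≤ ‖T x - y‖ := by
    rw [h1]
    exact ciInf_le ⟨0, by rintro _ ⟨z, rfl⟩; exact norm_nonneg _⟩
      (⟨y, Submodule.subset_span hy⟩ : U)
  simpa using h2.trans hxy.le

end Part2

section Part3

set_option linter.unusedSectionVars false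

namespace TensorPair

variable {E F EF F' EF' : Type*}
    [NormedAddCommGroup E] [InnerProductSpace ℂ E] [CompleteSpace E]
    [NormedAddCommGroup F] [InnerProductSpace ℂ F] [CompleteSpace F]
    [NormedAddCommGroup EF] [InnerProductSpace ℂ EF] [CompleteSpace EF]
    [NormedAddCommGroup F'] [InnerProductSpace ℂ F'] [CompleteSpace F']
    [NormedAddCommGroup EF'] [InnerProductSpace ℂ EF'] [CompleteSpace EF']

lemma adjoint_l_tmul (t : TensorPair E F EF) (ξ a : E) (b : F) :
    adjoint (t.l ξ) (t.tmul a b) = ⟪ξ, a⟫_ℂ • b := by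
  apply ext_inner_left ℂ
  intro v
  simp [adjoint_inner_right, t.inner_tmul, inner_smul_right]

lemma amp_l (t : TensorPair E F EF) (t' : TensorPair E F' EF') (b : F →L[ℂ] F') (ξ : E) :
    amp t t' b ∘L t.l ξ = t'.l ξ ∘L b := by ext; simp

lemma l_adj_amp (t : TensorPair E F EF) (t' : TensorPair E F' EF') (b : F →L[ℂ] F') (ξ : E) :
    adjoint (t'.l ξ) ∘L amp t t' b = b ∘L adjoint (t.l ξ) :=
  t.ext_clm fun x y => by simp [adjoint_l_tmul]

lemma amp_id (t : TensorPair E F EF) : amp t t (ContinuousLinearMap.id ℂ F) = .id ℂ EF :=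
  t.ext_clm fun x y => by simp

end TensorPair

variable {H H2 H3 : Type*}
    [NormedAddCommGroup H] [InnerProductSpace ℂ H] [CompleteSpace H]
    [NormedAddCommGroup H2] [InnerProductSpace ℂ H2] [CompleteSpace H2]
    [NormedAddCommGroup H3] [InnerProductSpace ℂ H3] [CompleteSpace H3]
    (t2 : TensorPair H H H2) (t3 : TensorTriple H H H H3)

open TensorPair

/-- Insertion of a vector in the first leg. -/
def L1 : H →L[ℂ] H2 →L[ℂ] H3 := (t3.assocR t2).l
/-- Insertion of a vector in the second leg. -/
def L2 (ξ : H) : H2 →L[ℂ] H3 := amp t2 (t3.assocR t2) (t2.l ξ)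
/-- The space of left insertions. -/
def lM : Submodule ℂ (H →L[ℂ] H2) := cl (Set.range t2.l)
/-- The space of right insertions. -/
def rM : Submodule ℂ (H →L[ℂ] H2) := cl (Set.range t2.flip.l)
/-- The space of insertions in the first leg. -/
def L1M : Submodule ℂ (H2 →L[ℂ] H3) := cl (Set.range (L1 t2 t3))
/-- The space of insertions in the second leg. -/
def L2M : Submodule ℂ (H2 →L[ℂ] H3) := cl (Set.range (L2 t2 t3))

lemma L1_tmul (a b c : H) : L1 t2 t3 a (t2.tmul b c) = t3.tmul a b c := by simp [L1]

lemma L2_tmul (a b c : H) : L2 t2 t3 b (t2.tmul a c) = t3.tmul a b c := by simp [L2]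

lemma L2_adj_tmul (ξ a b c : H) :
    adjoint (L2 t2 t3 ξ) (t3.tmul a b c) = ⟪ξ, b⟫_ℂ • t2.tmul a c := by
  rw [L2, amp_adjoint, ← t3.assocR_tmul t2, amp_tmul, adjoint_l_tmul, map_smul]

lemma L1_adj_tmul (ξ a b c : H) :
    adjoint (L1 t2 t3 ξ) (t3.tmul a b c) = ⟪ξ, a⟫_ℂ • t2.tmul b c := by
  rw [L1, ← t3.assocR_tmul t2, adjoint_l_tmul]

lemma W12_eq {W : H2 →L[ℂ] H2} {W12 : H3 →L[ℂ] H3} (h : IsLeg12 t2 t3 W W12) :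
    W12 = amp (t3.assocL t2).flip (t3.assocL t2).flip W := by
  apply t3.ext_clm t2
  intro a b c
  apply t3.ext_vec t2
  intro a' b' c'
  rw [h]
  simp only [← t3.assocL_tmul t2]
  rw [← flip_tmul (t3.assocL t2) (t2.tmul a b), amp_tmul, flip_tmul,
    (t3.assocL t2).inner_tmul]

lemma W23_eq {W : H2 →L[ℂ] H2} {W23 : H3 →L[ℂ] H3} (h : IsLeg23 t2 t3 W W23) :
    W23 = amp (t3.assocR t2) (t3.assocR t2) W := by
  apply t3.ext_clm t2
  intro a b c
  apply t3.ext_vec t2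
  intro a' b' c'
  rw [h]
  simp only [← t3.assocR_tmul t2]
  rw [amp_tmul, (t3.assocR t2).inner_tmul, mul_comm]

lemma W13_L2 {W : H2 →L[ℂ] H2} {W13 : H3 →L[ℂ] H3} (h : IsLeg13 t2 t3 W W13) (ξ : H) :
    W13 ∘L L2 t2 t3 ξ = L2 t2 t3 ξ ∘L W := by
  apply t2.ext_clm
  intro a c
  apply t3.ext_vec t2
  intro a' b' c'
  rw [coe_comp, Function.comp_apply, L2_tmul, h, coe_comp, Function.comp_apply,
    ← adjoint_inner_left (L2 t2 t3 ξ), L2_adj_tmul, inner_smul_left, inner_conj_symm, mul_comm]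

lemma L2_W13 {W : H2 →L[ℂ] H2} {W13 : H3 →L[ℂ] H3} (h : IsLeg13 t2 t3 W W13) (ξ : H) :
    adjoint (L2 t2 t3 ξ) ∘L W13 = W ∘L adjoint (L2 t2 t3 ξ) := by
  apply t3.ext_clm t2
  intro a b c
  apply t2.ext_vec
  intro a' c'
  rw [coe_comp, Function.comp_apply, coe_comp, Function.comp_apply, L2_adj_tmul,
    adjoint_inner_right, L2_tmul, h, map_smul, inner_smul_right, mul_comm]

lemma L2_l (ξ η : H) : L2 t2 t3 η ∘L t2.l ξ = L1 t2 t3 ξ ∘L t2.l η := by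
  ext x; simp [L2_tmul, L1_tmul]

lemma L2_l' (ξ η : H) : L2 t2 t3 η ∘L t2.l ξ = (t3.assocL t2).l (t2.tmul ξ η) := by
  ext x; simp [L2_tmul]

lemma L1_adj_assoc (ξ : H) (z : H2) (y : H) :
    adjoint (L1 t2 t3 ξ) ((t3.assocL t2).tmul z y) = t2.tmul (adjoint (t2.l ξ) z) y := by
  have : adjoint (L1 t2 t3 ξ) ∘L (t3.assocL t2).flip.l y = t2.flip.l y ∘L adjoint (t2.l ξ) :=
    t2.ext_clm fun a b => by simp [L1_adj_tmul, adjoint_l_tmul]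
  exact congrArg (fun f => f z) this

lemma L2_adj_assoc (ξ : H) (z : H2) (y : H) :
    adjoint (L2 t2 t3 ξ) ((t3.assocL t2).tmul z y) = t2.tmul (adjoint (t2.flip.l ξ) z) y := by
  have : adjoint (L2 t2 t3 ξ) ∘L (t3.assocL t2).flip.l y =
      t2.flip.l y ∘L adjoint (t2.flip.l ξ) :=
    t2.ext_clm fun a b => by
      have : adjoint (t2.flip.l ξ) (t2.tmul a b) = _ := adjoint_l_tmul t2.flip ξ b a
      simp [L2_adj_tmul, this]
  exact congrArg (fun f => f z) this

lemma W12_L2_tmul {W : H2 →L[ℂ] H2} {W12 : H3 →L[ℂ] H3} (h : IsLeg12 t2 t3 W W12)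
    (η x y : H) : W12 (L2 t2 t3 η (t2.tmul x y)) =
      (t3.assocL t2).tmul (W (t2.tmul x η)) y := by
  rw [L2_tmul, W12_eq t2 t3 h, ← t3.assocL_tmul t2]
  exact amp_tmul (t3.assocL t2).flip (t3.assocL t2).flip W y (t2.tmul x η)

lemma L1_W12_L2 {W : H2 →L[ℂ] H2} {W12 : H3 →L[ℂ] H3} (h : IsLeg12 t2 t3 W W12) (ξ η : H) :
    adjoint (L1 t2 t3 ξ) ∘L (W12 ∘L L2 t2 t3 η) =
      amp t2.flip t2.flip (adjoint (t2.l ξ) ∘L (W ∘L t2.flip.l η)) := by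
  apply t2.ext_clm
  intro x y
  rw [coe_comp, Function.comp_apply, coe_comp, Function.comp_apply, W12_L2_tmul t2 t3 h,
    L1_adj_assoc]
  exact (amp_tmul t2.flip t2.flip (adjoint (t2.l ξ) ∘L (W ∘L t2.flip.l η)) y x).symm

lemma L2_W12_L2 {W : H2 →L[ℂ] H2} {W12 : H3 →L[ℂ] H3} (h : IsLeg12 t2 t3 W W12) (ξ η : H) :
    adjoint (L2 t2 t3 ξ) ∘L (W12 ∘L L2 t2 t3 η) =
      amp t2.flip t2.flip (adjoint (t2.flip.l ξ) ∘L (W ∘L t2.flip.l η)) := by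
  apply t2.ext_clm
  intro x y
  rw [coe_comp, Function.comp_apply, coe_comp, Function.comp_apply, W12_L2_tmul t2 t3 h,
    L2_adj_assoc]
  exact (amp_tmul t2.flip t2.flip (adjoint (t2.flip.l ξ) ∘L (W ∘L t2.flip.l η)) y x).symm

lemma amp_rankOne (β γ : H) :
    amp t2.flip t2.flip (InnerProductSpace.rankOne ℂ β γ) = t2.l β ∘L adjoint (t2.l γ) := by
  apply t2.ext_clm
  intro x y
  have := amp_tmul t2.flip t2.flip (InnerProductSpace.rankOne ℂ β γ) y x
  simp only [flip_tmul] at this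
  rw [this]
  simp [adjoint_l_tmul]

/-! Relations between the spaces -/

lemma adj_lM : adj (lM t2) = cl (Set.range fun ξ => adjoint (t2.l ξ)) := by
  rw [lM, adj_cl, ← Set.range_comp]; rfl

lemma adj_L1M : adj (L1M t2 t3) = cl (Set.range fun ξ => adjoint (L1 t2 t3 ξ)) := by
  rw [L1M, adj_cl, ← Set.range_comp]; rfl

lemma adj_L2M : adj (L2M t2 t3) = cl (Set.range fun ξ => adjoint (L2 t2 t3 ξ)) := by
  rw [L2M, adj_cl, ← Set.range_comp]; rfl

lemma adj_rM : adj (rM t2) = cl (Set.range fun ξ => adjoint (t2.flip.l ξ)) := by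
  rw [rM, adj_cl, ← Set.range_comp]; rfl

section
variable {E F G K : Type*}
    [NormedAddCommGroup E] [InnerProductSpace ℂ E]
    [NormedAddCommGroup F] [InnerProductSpace ℂ F]
    [NormedAddCommGroup G] [InnerProductSpace ℂ G]
    [NormedAddCommGroup K] [InnerProductSpace ℂ K]

lemma cl_range_mul {α β : Type*} (f : α → F →L[ℂ] G) (g : β → E →L[ℂ] F) :
    cl (Set.range f) ⋆⋆ cl (Set.range g) = cl (Set.range fun p : α × β => f p.1 ∘L g p.2) := by
  rw [cl_mul_cl, pr, Set.image2_range]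

lemma sing_mul_range {β : Type*} (S : F →L[ℂ] G) (g : β → E →L[ℂ] F) :
    sing S ⋆⋆ cl (Set.range g) = cl (Set.range fun p => S ∘L g p) := by
  rw [sing_mul_cl, ← Set.range_comp]; rfl

lemma range_mul_sing {β : Type*} (g : β → F →L[ℂ] G) (S : E →L[ℂ] F) :
    cl (Set.range g) ⋆⋆ sing S = cl (Set.range fun p => g p ∘L S) := by
  rw [cl_mul_sing, ← Set.range_comp]; rfl

lemma cl_range_triple {α β : Type*} (f : α → G →L[ℂ] K) (S : F →L[ℂ] G) (g : β → E →L[ℂ] F) :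
    cl (Set.range f) ⋆⋆ sing S ⋆⋆ cl (Set.range g) =
      cl (Set.range fun p : α × β => f p.1 ∘L (S ∘L g p.2)) := by
  rw [sing_mul_range, cl_range_mul]
end

lemma rel_L2_l : L2M t2 t3 ⋆⋆ lM t2 = L1M t2 t3 ⋆⋆ lM t2 := by
  rw [L2M, L1M, lM, cl_range_mul, cl_range_mul]
  congr 1
  ext T
  constructor
  · rintro ⟨⟨a, b⟩, rfl⟩; exact ⟨(b, a), (L2_l t2 t3 b a).symm⟩
  · rintro ⟨⟨a, b⟩, rfl⟩; exact ⟨(b, a), (L2_l t2 t3 a b)⟩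

lemma L2M_lM : L2M t2 t3 ⋆⋆ lM t2 = cl (Set.range (t3.assocL t2).l) := by
  rw [L2M, lM, cl_range_mul]
  apply le_antisymm
  · apply cl_le_cl
    rintro _ ⟨⟨a, b⟩, rfl⟩
    exact mem_cl ⟨t2.tmul b a, (L2_l' t2 t3 b a).symm⟩
  · apply cl_le_cl
    rintro _ ⟨z, rfl⟩
    have hz : z ∈ cl {z : H2 | ∃ a b, z = t2.tmul a b} := t2.dense_span z
    refine mem_cl_of_map (t3.assocL t2).l ?_ hz
    rintro _ ⟨a, b, rfl⟩
    exact mem_cl ⟨(b, a), L2_l' t2 t3 a b⟩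

lemma rel_abs {W : H2 →L[ℂ] H2} {W12 : H3 →L[ℂ] H3} (h : IsLeg12 t2 t3 W W12)
    (hs : Function.Surjective W) :
    sing W12 ⋆⋆ L2M t2 t3 ⋆⋆ lM t2 = L2M t2 t3 ⋆⋆ lM t2 := by
  rw [L2M_lM, sing_mul_range]
  congr 1
  have : (fun z => W12 ∘L (t3.assocL t2).l z) = (t3.assocL t2).l ∘ W := by
    funext z
    ext y
    rw [W12_eq t2 t3 h]
    exact amp_tmul (t3.assocL t2).flip (t3.assocL t2).flip W y z
  rw [this, hs.range_comp]

lemma rel_L1_L1_l : adj (L1M t2 t3) ⋆⋆ L1M t2 t3 ⋆⋆ lM t2 = lM t2 := by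
  rw [adj_L1M, L1M, lM, cl_range_mul, cl_range_mul]
  have key : ∀ ξ η ζ : H, adjoint (L1 t2 t3 ξ) ∘L (L1 t2 t3 η ∘L t2.l ζ) =
      ⟪ξ, η⟫_ℂ • t2.l ζ := fun ξ η ζ => by
    ext x; simp [L1_tmul, L1_adj_tmul]
  apply le_antisymm
  · apply cl_le_cl
    rintro _ ⟨⟨a, b, c⟩, rfl⟩
    change _ ∈ cl _
    simp only [key]
    exact Submodule.smul_mem _ _ (mem_cl ⟨c, rfl⟩)
  · apply cl_le_cl
    rintro _ ⟨c, rfl⟩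
    change _ ∈ cl _
    by_cases hc : c = 0
    · rw [hc, map_zero]; exact Submodule.zero_mem _
    · have h0 : ⟪c, c⟫_ℂ ≠ 0 := by simpa using hc
      have : t2.l c = (⟪c, c⟫_ℂ)⁻¹ • (adjoint (L1 t2 t3 c) ∘L (L1 t2 t3 c ∘L t2.l c)) := by
        rw [key, smul_smul, inv_mul_cancel₀ h0, one_smul]
      rw [this]
      exact Submodule.smul_mem _ _ (mem_cl ⟨(c, c, c), rfl⟩)

lemma rel_W13_L2 {W : H2 →L[ℂ] H2} {W13 : H3 →L[ℂ] H3} (h : IsLeg13 t2 t3 W W13) :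
    sing W13 ⋆⋆ L2M t2 t3 = L2M t2 t3 ⋆⋆ sing W := by
  rw [L2M, sing_mul_range, range_mul_sing]
  simp only [W13_L2 t2 t3 h]

lemma rel_L2_W13 {W : H2 →L[ℂ] H2} {W13 : H3 →L[ℂ] H3} (h : IsLeg13 t2 t3 W W13) :
    adj (L2M t2 t3) ⋆⋆ sing W13 = sing W ⋆⋆ adj (L2M t2 t3) := by
  rw [adj_L2M, sing_mul_range, range_mul_sing]
  simp only [L2_W13 t2 t3 h]

lemma rel_W23_L1 {W : H2 →L[ℂ] H2} {W23 : H3 →L[ℂ] H3} (h : IsLeg23 t2 t3 W W23) :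
    sing W23 ⋆⋆ L1M t2 t3 = L1M t2 t3 ⋆⋆ sing W := by
  rw [L1M, sing_mul_range, range_mul_sing]
  simp only [L1, W23_eq t2 t3 h, amp_l]

lemma rel_L1_W23 {W : H2 →L[ℂ] H2} {W23 : H3 →L[ℂ] H3} (h : IsLeg23 t2 t3 W W23) :
    adj (L1M t2 t3) ⋆⋆ sing W23 = sing W ⋆⋆ adj (L1M t2 t3) := by
  rw [adj_L1M, sing_mul_range, range_mul_sing]
  simp only [L1, W23_eq t2 t3 h, l_adj_amp]

lemma rel_reg {W : H2 →L[ℂ] H2} {W12 : H3 →L[ℂ] H3} (h : IsLeg12 t2 t3 W W12)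
    (hreg : adj (lM t2) ⋆⋆ sing W ⋆⋆ rM t2 =
      cl (Set.range fun p : H × H => InnerProductSpace.rankOne ℂ p.1 p.2)) :
    adj (L1M t2 t3) ⋆⋆ sing W12 ⋆⋆ L2M t2 t3 = lM t2 ⋆⋆ adj (lM t2) := by
  rw [adj_L1M, L2M, cl_range_triple]
  simp only [L1_W12_L2 t2 t3 h]
  have h1 := congrArg (mapM (amp t2.flip t2.flip)) hreg
  rw [adj_lM, rM, cl_range_triple, mapM_cl, mapM_cl, ← Set.range_comp, ← Set.range_comp] at h1
  rw [adj_lM, lM, cl_range_mul]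
  refine h1.trans ?_
  congr 2
  funext p
  exact amp_rankOne t2 p.1 p.2

lemma mapM_lM : mapM (amp t2 (t3.assocR t2)) (lM t2) = L2M t2 t3 := by
  rw [lM, mapM_cl, ← Set.range_comp]; rfl

lemma mapM_adj_lM : mapM (amp (t3.assocR t2) t2) (adj (lM t2)) = adj (L2M t2 t3) := by
  rw [adj_lM, mapM_cl, ← Set.range_comp, adj_L2M]
  congr 2
  funext ξ
  exact (amp_adjoint _ _ _).symm

lemma rel_l_amp {EF F : Type*} [NormedAddCommGroup F] [InnerProductSpace ℂ F] [CompleteSpace F]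
    [NormedAddCommGroup EF] [InnerProductSpace ℂ EF] [CompleteSpace EF] (t : TensorPair H F EF)
    (P : Submodule ℂ (F →L[ℂ] F)) :
    mapM (amp t t) P ⋆⋆ cl (Set.range t.l) = cl (Set.range t.l) ⋆⋆ P := by
  rw [mapM, cl_mul_cl, mul_cl_cl]
  congr 1
  ext T
  constructor
  · rintro ⟨_, ⟨b, hb, rfl⟩, _, ⟨ξ, rfl⟩, rfl⟩
    exact ⟨t.l ξ, ⟨ξ, rfl⟩, b, hb, (amp_l t t b ξ).symm⟩
  · rintro ⟨_, ⟨ξ, rfl⟩, b, hb, rfl⟩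
    exact ⟨_, ⟨b, hb, rfl⟩, _, ⟨ξ, rfl⟩, amp_l t t b ξ⟩

lemma rel_amp_l_adj {EF F : Type*} [NormedAddCommGroup F] [InnerProductSpace ℂ F]
    [CompleteSpace F]
    [NormedAddCommGroup EF] [InnerProductSpace ℂ EF] [CompleteSpace EF] (t : TensorPair H F EF)
    (P : Submodule ℂ (F →L[ℂ] F)) :
    cl (Set.range fun ξ => adjoint (t.l ξ)) ⋆⋆ mapM (amp t t) P =
      P ⋆⋆ cl (Set.range fun ξ => adjoint (t.l ξ)) := by
  rw [mapM, cl_mul_cl, mul_cl_right]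
  congr 1
  ext T
  constructor
  · rintro ⟨_, ⟨ξ, rfl⟩, _, ⟨b, hb, rfl⟩, rfl⟩
    exact ⟨b, hb, _, ⟨ξ, rfl⟩, (l_adj_amp t t b ξ).symm⟩
  · rintro ⟨b, hb, _, ⟨ξ, rfl⟩, rfl⟩
    exact ⟨_, ⟨ξ, rfl⟩, _, ⟨b, hb, rfl⟩, l_adj_amp t t b ξ⟩

lemma rel_W12_T3 {W : H2 →L[ℂ] H2} {W12 : H3 →L[ℂ] H3} (h : IsLeg12 t2 t3 W W12)
    (P : Submodule ℂ (H →L[ℂ] H)) :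
    sing W12 ⋆⋆ mapM (amp (t3.assocR t2) (t3.assocR t2)) (mapM (amp t2 t2) P) =
      mapM (amp (t3.assocR t2) (t3.assocR t2)) (mapM (amp t2 t2) P) ⋆⋆ sing W12 := by
  have hT : ∀ b : H →L[ℂ] H, ∀ z c, amp (t3.assocR t2) (t3.assocR t2) (amp t2 t2 b)
      ((t3.assocL t2).tmul z c) = (t3.assocL t2).tmul z (b c) := by
    intro b z c
    have : amp (t3.assocR t2) (t3.assocR t2) (amp t2 t2 b) ∘L (t3.assocL t2).flip.l c =
        (t3.assocL t2).flip.l (b c) := t2.ext_clm fun x y => by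
      simp only [coe_comp, Function.comp_apply, l_apply, flip_tmul, TensorTriple.assocL_tmul]
      rw [← t3.assocR_tmul t2, amp_tmul, amp_tmul, t3.assocR_tmul t2]
    exact congrArg (fun f => f z) this
  have key : ∀ b : H →L[ℂ] H, W12 ∘L amp (t3.assocR t2) (t3.assocR t2) (amp t2 t2 b) =
      amp (t3.assocR t2) (t3.assocR t2) (amp t2 t2 b) ∘L W12 := by
    intro b
    apply (t3.assocL t2).ext_clm
    intro z c
    have h12 : ∀ z c, W12 ((t3.assocL t2).tmul z c) = (t3.assocL t2).tmul (W z) c := by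
      intro z c
      rw [W12_eq t2 t3 h]
      exact amp_tmul (t3.assocL t2).flip (t3.assocL t2).flip W c z
    simp only [coe_comp, Function.comp_apply, hT, h12]
  have : mapM (amp (t3.assocR t2) (t3.assocR t2)) (mapM (amp t2 t2) P) =
      cl ((amp (t3.assocR t2) (t3.assocR t2)) '' ((amp t2 t2) '' (P : Set (H →L[ℂ] H)))) :=
    mapM_cl _ _
  rw [this, sing_mul_cl, cl_mul_sing]
  simp only [Set.image_image, key]

end Part3

section Part4

set_option linter.unusedSectionVars false

section core
variable {H H2 H3 : Type*}
    [NormedAddCommGroup H] [InnerProductSpace ℂ H]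
    [NormedAddCommGroup H2] [InnerProductSpace ℂ H2]
    [NormedAddCommGroup H3] [InnerProductSpace ℂ H3]
    {l : Submodule ℂ (H →L[ℂ] H2)} {ld : Submodule ℂ (H2 →L[ℂ] H)}
    {L1 L2 : Submodule ℂ (H2 →L[ℂ] H3)} {L1d L2d : Submodule ℂ (H3 →L[ℂ] H2)}
    {w ws fA f1 : Submodule ℂ (H2 →L[ℂ] H2)} {A : Submodule ℂ (H →L[ℂ] H)}
    {w12 w12s w13 w13s w23 w23s T : Submodule ℂ (H3 →L[ℂ] H3)}

lemma ra3 {E F G K M : Type*}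
    [NormedAddCommGroup E] [InnerProductSpace ℂ E]
    [NormedAddCommGroup F] [InnerProductSpace ℂ F]
    [NormedAddCommGroup G] [InnerProductSpace ℂ G]
    [NormedAddCommGroup K] [InnerProductSpace ℂ K]
    [NormedAddCommGroup M] [InnerProductSpace ℂ M]
    {P : Submodule ℂ (G →L[ℂ] K)} {Q : Submodule ℂ (F →L[ℂ] G)}
    {R : Submodule ℂ (E →L[ℂ] F)} {Z : Submodule ℂ (E →L[ℂ] K)}
    (h : P ⋆⋆ Q ⋆⋆ R = Z) (X : Submodule ℂ (M →L[ℂ] E)) :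
    P ⋆⋆ Q ⋆⋆ R ⋆⋆ X = Z ⋆⋆ X := by
  rw [← h, mulM_assoc, mulM_assoc]

lemma core0
    (hregd : L2d ⋆⋆ w12s ⋆⋆ L1 = l ⋆⋆ ld)
    (h1 : ws ⋆⋆ L2d = L2d ⋆⋆ w13s)
    (h2 : w23 ⋆⋆ L1 = L1 ⋆⋆ w)
    (hp : w13s ⋆⋆ w12s ⋆⋆ w23 = w23 ⋆⋆ w12s)
    (h3 : ld ⋆⋆ L2d = ld ⋆⋆ L1d)
    (h4 : L2 ⋆⋆ l = L1 ⋆⋆ l)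
    (habs : w12s ⋆⋆ L2 ⋆⋆ l = L2 ⋆⋆ l)
    (h5 : L1d ⋆⋆ w23 = w ⋆⋆ L1d)
    (h6 : L1d ⋆⋆ L1 ⋆⋆ l = l) :
    (ld ⋆⋆ ws ⋆⋆ l) ⋆⋆ (ld ⋆⋆ w ⋆⋆ l) = ld ⋆⋆ w ⋆⋆ l := by
  simp only [mulM_assoc]
  rw [ra hregd.symm, mulM_assoc, ra h1, ← ra h2, ra3 hp, mulM_assoc, ra h3, ← h4, habs, h4,
    ra h5, h6]

lemma core1
    (hregd : L2d ⋆⋆ w12s ⋆⋆ L1 = l ⋆⋆ ld)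
    (hfA : L2d ⋆⋆ w23 ⋆⋆ L2 = fA)
    (hl : fA ⋆⋆ l = l ⋆⋆ (ld ⋆⋆ w ⋆⋆ l))
    (h1 : w ⋆⋆ L2d = L2d ⋆⋆ w13)
    (hp : w13 ⋆⋆ w23 = w12s ⋆⋆ w23 ⋆⋆ w12)
    (habs : w12 ⋆⋆ L2 ⋆⋆ l = L2 ⋆⋆ l)
    (h4 : L2 ⋆⋆ l = L1 ⋆⋆ l)
    (h2 : w23 ⋆⋆ L1 = L1 ⋆⋆ w) :
    w ⋆⋆ l ⋆⋆ (ld ⋆⋆ w ⋆⋆ l) = l ⋆⋆ (ld ⋆⋆ w ⋆⋆ l) := by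
  rw [← hl]
  conv_rhs => rw [hl]
  rw [← hfA]
  simp only [mulM_assoc]
  rw [ra h1, ra hp]
  simp only [mulM_assoc]
  rw [habs, h4, ra h2, ra3 hregd, mulM_assoc]

lemma core2
    (hreg : L1d ⋆⋆ w12 ⋆⋆ L2 = l ⋆⋆ ld)
    (hfA : L2d ⋆⋆ w23 ⋆⋆ L2 = fA)
    (hl : ld ⋆⋆ fA = (ld ⋆⋆ w ⋆⋆ l) ⋆⋆ ld)
    (h1 : w ⋆⋆ L2d = L2d ⋆⋆ w13)
    (hp : w13 ⋆⋆ w23 = w12s ⋆⋆ w23 ⋆⋆ w12)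
    (habs : ld ⋆⋆ L2d ⋆⋆ w12s = ld ⋆⋆ L2d)
    (h3 : ld ⋆⋆ L2d = ld ⋆⋆ L1d)
    (h5 : L1d ⋆⋆ w23 = w ⋆⋆ L1d) :
    ld ⋆⋆ w ⋆⋆ fA = ld ⋆⋆ fA := by
  rw [hl, ← hfA, ra h1, ra hp]
  simp only [mulM_assoc]
  rw [ra3 habs, mulM_assoc, ra h3, ra h5, hreg]

lemma core3
    (hf1 : L2d ⋆⋆ w12 ⋆⋆ L2 = f1)
    (h1 : w13 ⋆⋆ L2 = L2 ⋆⋆ w)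
    (hp : w12 ⋆⋆ w13 = w23 ⋆⋆ w12 ⋆⋆ w23s)
    (h2 : w23s ⋆⋆ L2 ⋆⋆ fA = L2 ⋆⋆ fA)
    (h3 : L2 ⋆⋆ fA = T ⋆⋆ L2)
    (h4 : w12 ⋆⋆ T = T ⋆⋆ w12)
    (h5 : L2d ⋆⋆ w23 ⋆⋆ T = L2d ⋆⋆ T)
    (h6 : L2d ⋆⋆ T = fA ⋆⋆ L2d) :
    f1 ⋆⋆ w ⋆⋆ fA = fA ⋆⋆ f1 := by
  rw [← hf1]
  simp only [mulM_assoc]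
  rw [← ra h1, ra hp]
  simp only [mulM_assoc]
  rw [h2, h3, ra h4, ra3 h5, mulM_assoc, ra h6]
end core

lemma sing_id_mul {E F : Type*}
    [NormedAddCommGroup E] [InnerProductSpace ℂ E]
    [NormedAddCommGroup F] [InnerProductSpace ℂ F] (S : Set (E →L[ℂ] F)) :
    sing (ContinuousLinearMap.id ℂ F) ⋆⋆ cl S = cl S := by
  rw [sing_mul_cl]; simp

/-- Moving a unitary to the other side of an absorption relation. -/
lemma abs_star {E F G : Type*}
    [NormedAddCommGroup E] [InnerProductSpace ℂ E]
    [NormedAddCommGroup F] [InnerProductSpace ℂ F]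
    [NormedAddCommGroup G] [InnerProductSpace ℂ G]
    {U V : F →L[ℂ] F} (hVU : V ∘L U = .id ℂ F)
    {P : Submodule ℂ (G →L[ℂ] F)} {Q : Submodule ℂ (E →L[ℂ] G)}
    (h : sing U ⋆⋆ P ⋆⋆ Q = P ⋆⋆ Q) : sing V ⋆⋆ P ⋆⋆ Q = P ⋆⋆ Q := by
  have : sing V ⋆⋆ P ⋆⋆ Q = sing V ⋆⋆ sing U ⋆⋆ P ⋆⋆ Q := by rw [h]
  rw [this, ← mulM_assoc, sing_mul_sing, hVU, mulM, mulM, ← mulM]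
  exact sing_id_mul _

variable {H H2 H3 : Type*}
    [NormedAddCommGroup H] [InnerProductSpace ℂ H] [CompleteSpace H]
    [NormedAddCommGroup H2] [InnerProductSpace ℂ H2] [CompleteSpace H2]
    [NormedAddCommGroup H3] [InnerProductSpace ℂ H3] [CompleteSpace H3]
    (t2 : TensorPair H H H2) (t3 : TensorTriple H H H H3)

open TensorPair

lemma amp_unitary {EF F : Type*} [NormedAddCommGroup F] [InnerProductSpace ℂ F] [CompleteSpace F]
    [NormedAddCommGroup EF] [InnerProductSpace ℂ EF] [CompleteSpace EF] (t : TensorPair H F EF)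
    {W : F →L[ℂ] F} (h : adjoint W ∘L W = .id ℂ F ∧ W ∘L adjoint W = .id ℂ F) :
    adjoint (amp t t W) ∘L amp t t W = .id ℂ EF ∧ amp t t W ∘L adjoint (amp t t W) = .id ℂ EF := by
  rw [amp_adjoint, ← amp_comp, ← amp_comp, h.1, h.2, amp_id]
  exact ⟨rfl, rfl⟩

/-- The main identity, in terms of spaces of operators. -/
lemma main_core (W : H2 →L[ℂ] H2)
    (hWu : adjoint W ∘L W = .id ℂ H2 ∧ W ∘L adjoint W = .id ℂ H2)
    (W12 W23 W13 : H3 →L[ℂ] H3)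
    (hW12 : IsLeg12 t2 t3 W W12) (hW23 : IsLeg23 t2 t3 W W23)
    (hW13 : IsLeg13 t2 t3 W W13)
    (hpent : W23 * W12 = W12 * W13 * W23)
    (hreg : adj (lM t2) ⋆⋆ sing W ⋆⋆ rM t2 =
      cl (Set.range fun p : H × H => InnerProductSpace.rankOne ℂ p.1 p.2)) :
    mapM (amp t2.flip t2.flip) (adj (rM t2) ⋆⋆ sing W ⋆⋆ rM t2) ⋆⋆ sing W ⋆⋆
        mapM (amp t2 t2) (adj (lM t2) ⋆⋆ sing (adjoint W) ⋆⋆ lM t2) =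
      mapM (amp t2 t2) (adj (lM t2) ⋆⋆ sing (adjoint W) ⋆⋆ lM t2) ⋆⋆
        mapM (amp t2.flip t2.flip) (adj (rM t2) ⋆⋆ sing W ⋆⋆ rM t2) := by
  obtain ⟨u12, v12⟩ := amp_unitary (t3.assocL t2).flip hWu
  rw [← W12_eq t2 t3 hW12] at u12 v12
  obtain ⟨u23, v23⟩ := amp_unitary (t3.assocR t2) hWu
  rw [← W23_eq t2 t3 hW23] at u23 v23
  have hs : Function.Surjective W := fun y => ⟨adjoint W y, congrArg (fun f => f y) hWu.2⟩
  change adjoint W12 * W12 = 1 at u12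
  change W12 * adjoint W12 = 1 at v12
  change adjoint W23 * W23 = 1 at u23
  change W23 * adjoint W23 = 1 at v23
  have p1 : W13 * W23 = adjoint W12 * (W23 * W12) := by
    rw [hpent, mul_assoc, ← mul_assoc, u12, one_mul]
  have p2 : W12 * W13 = W23 * (W12 * adjoint W23) := by
    rw [← mul_assoc, hpent, mul_assoc, v23, mul_one]
  have p3 : adjoint W13 * (adjoint W12 * W23) = W23 * adjoint W12 := by
    have h := congrArg star p2
    simp only [star_mul, star_eq_adjoint, adjoint_adjoint] at h
    rw [← mul_assoc, h, mul_assoc, u23, mul_one]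
  have q1 : sing W13 ⋆⋆ sing W23 = sing (adjoint W12) ⋆⋆ sing W23 ⋆⋆ sing W12 := by
    simp only [sing_mul_sing]; exact congrArg sing p1
  have q2 : sing W12 ⋆⋆ sing W13 = sing W23 ⋆⋆ sing W12 ⋆⋆ sing (adjoint W23) := by
    simp only [sing_mul_sing]; exact congrArg sing p2
  have q3 : sing (adjoint W13) ⋆⋆ sing (adjoint W12) ⋆⋆ sing W23 =
      sing W23 ⋆⋆ sing (adjoint W12) := by
    simp only [sing_mul_sing]; exact congrArg sing p3
  have habs := rel_abs t2 t3 hW12 hs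
  have habss : sing (adjoint W12) ⋆⋆ L2M t2 t3 ⋆⋆ lM t2 = L2M t2 t3 ⋆⋆ lM t2 :=
    abs_star u12 habs
  have habsd : adj (lM t2) ⋆⋆ adj (L2M t2 t3) ⋆⋆ sing (adjoint W12) =
      adj (lM t2) ⋆⋆ adj (L2M t2 t3) := by
    have := congrArg adj habs
    simpa only [adj_mul, adj_sing, mulM_assoc] using this
  have hr := rel_reg t2 t3 hW12 hreg
  have hrd : adj (L2M t2 t3) ⋆⋆ sing (adjoint W12) ⋆⋆ L1M t2 t3 = lM t2 ⋆⋆ adj (lM t2) := by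
    have := congrArg adj hr
    simpa only [adj_mul, adj_sing, mulM_assoc, adj_adj] using this
  have h13d : sing (adjoint W) ⋆⋆ adj (L2M t2 t3) = adj (L2M t2 t3) ⋆⋆ sing (adjoint W13) := by
    have := congrArg adj (rel_W13_L2 t2 t3 hW13)
    simpa only [adj_mul, adj_sing, mulM_assoc, adj_adj] using this.symm
  have hLl := rel_L2_l t2 t3
  have hLld : adj (lM t2) ⋆⋆ adj (L2M t2 t3) = adj (lM t2) ⋆⋆ adj (L1M t2 t3) := by
    have := congrArg adj hLl
    simpa only [adj_mul] using this
  have hA0 := core0 hrd h13d (rel_W23_L1 t2 t3 hW23) q3 hLld hLl habss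
    (rel_L1_W23 t2 t3 hW23) (rel_L1_L1_l t2 t3)
  have hAd : adj (adj (lM t2) ⋆⋆ sing W ⋆⋆ lM t2) =
      adj (lM t2) ⋆⋆ sing (adjoint W) ⋆⋆ lM t2 := by
    simp only [adj_mul, adj_sing, mulM_assoc, adj_adj]
  have hA : adj (lM t2) ⋆⋆ sing (adjoint W) ⋆⋆ lM t2 = adj (lM t2) ⋆⋆ sing W ⋆⋆ lM t2 := by
    rw [← hAd] at hA0 ⊢
    conv_lhs => rw [← hA0]
    rw [adj_mul, adj_adj, hA0]
  rw [hA]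
  set A := adj (lM t2) ⋆⋆ sing W ⋆⋆ lM t2 with hAdef
  set fA := mapM (amp t2 t2) A with hfA
  have hfA' : adj (L2M t2 t3) ⋆⋆ sing W23 ⋆⋆ L2M t2 t3 = fA := by
    rw [hfA, hAdef, mapM_mul (amp t2 (t3.assocR t2)) (amp (t3.assocR t2) t2) (amp t2 t2)
      (fun s t => amp_comp _ _ _ _ _), mapM_adj_lM,
      mapM_mul (amp t2 (t3.assocR t2)) (amp (t3.assocR t2) (t3.assocR t2))
        (amp t2 (t3.assocR t2)) (fun s t => amp_comp _ _ _ _ _), mapM_lM, mapM_sing,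
      ← W23_eq t2 t3 hW23]
  have hl1 : fA ⋆⋆ lM t2 = lM t2 ⋆⋆ A := rel_l_amp t2 A
  have hl2 : adj (lM t2) ⋆⋆ fA = A ⋆⋆ adj (lM t2) := by
    rw [adj_lM]; exact rel_amp_l_adj t2 A
  have c1 : sing W ⋆⋆ lM t2 ⋆⋆ A = lM t2 ⋆⋆ A :=
    core1 hrd hfA' hl1 (rel_L2_W13 t2 t3 hW13).symm q1 habs hLl (rel_W23_L1 t2 t3 hW23)
  have c1s : sing (adjoint W) ⋆⋆ lM t2 ⋆⋆ A = lM t2 ⋆⋆ A := abs_star hWu.1 c1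
  have c2 : adj (lM t2) ⋆⋆ sing W ⋆⋆ fA = adj (lM t2) ⋆⋆ fA :=
    core2 hr hfA' hl2 (rel_L2_W13 t2 t3 hW13).symm q1 habsd hLld (rel_L1_W23 t2 t3 hW23)
  have hW23' := W23_eq t2 t3 hW23
  have hW23s : amp (t3.assocR t2) (t3.assocR t2) (adjoint W) = adjoint W23 := by
    rw [hW23', amp_adjoint]
  refine core3 (L2 := L2M t2 t3) (L2d := adj (L2M t2 t3)) (w12 := sing W12) (w13 := sing W13)
    (w23 := sing W23) (w23s := sing (adjoint W23))
    (T := mapM (amp (t3.assocR t2) (t3.assocR t2)) fA) ?_ (rel_W13_L2 t2 t3 hW13) q2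
    ?_ ?_ (rel_W12_T3 t2 t3 hW12 A) ?_ ?_
  · rw [adj_L2M, L2M, cl_range_triple, adj_rM, rM, cl_range_triple, mapM_cl, ← Set.range_comp]
    simp only [L2_W12_L2 t2 t3 hW12]
    rfl
  · have := congrArg (mapM (amp t2 (t3.assocR t2))) c1s
    rwa [mapM_mul (amp t2 (t3.assocR t2)) (amp (t3.assocR t2) (t3.assocR t2))
        (amp t2 (t3.assocR t2)) (fun s t => amp_comp _ _ _ _ _),
      mapM_mul (amp t2 t2) (amp t2 (t3.assocR t2))
        (amp t2 (t3.assocR t2)) (fun s t => amp_comp _ _ _ _ _), mapM_lM, mapM_sing,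
      hW23s] at this
  · have := congrArg (mapM (amp t2 (t3.assocR t2))) hl1
    rw [mapM_mul (amp t2 (t3.assocR t2)) (amp (t3.assocR t2) (t3.assocR t2))
        (amp t2 (t3.assocR t2)) (fun s t => amp_comp _ _ _ _ _),
      mapM_mul (amp t2 t2) (amp t2 (t3.assocR t2))
        (amp t2 (t3.assocR t2)) (fun s t => amp_comp _ _ _ _ _), mapM_lM] at this
    exact this.symm
  · have := congrArg (mapM (amp (t3.assocR t2) t2)) c2
    rwa [mapM_mul (amp (t3.assocR t2) (t3.assocR t2)) (amp (t3.assocR t2) t2)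
        (amp (t3.assocR t2) t2) (fun s t => amp_comp _ _ _ _ _),
      mapM_mul (amp (t3.assocR t2) (t3.assocR t2)) (amp (t3.assocR t2) (t3.assocR t2))
        (amp (t3.assocR t2) (t3.assocR t2)) (fun s t => amp_comp _ _ _ _ _),
      mapM_mul (amp (t3.assocR t2) (t3.assocR t2)) (amp (t3.assocR t2) t2)
        (amp (t3.assocR t2) t2) (fun s t => amp_comp _ _ _ _ _),
      mapM_adj_lM, mapM_sing, ← hW23'] at this
  · have := congrArg (mapM (amp (t3.assocR t2) t2)) hl2
    rwa [mapM_mul (amp (t3.assocR t2) (t3.assocR t2)) (amp (t3.assocR t2) t2)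
        (amp (t3.assocR t2) t2) (fun s t => amp_comp _ _ _ _ _),
      mapM_mul (amp (t3.assocR t2) t2) (amp t2 t2)
        (amp (t3.assocR t2) t2) (fun s t => amp_comp _ _ _ _ _),
      mapM_adj_lM] at this

lemma slicesR_eq (X : H2 →L[ℂ] H2) : slicesR t2 t2 X =
    Set.range fun p : H × H => adjoint (t2.flip.l p.1) ∘L (X ∘L t2.flip.l p.2) := by
  have key : ∀ ξ η ζ ζ' : H, ⟪ζ, (adjoint (t2.flip.l ξ) ∘L (X ∘L t2.flip.l η)) ζ'⟫_ℂ =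
      ⟪t2.tmul ζ ξ, X (t2.tmul ζ' η)⟫_ℂ := by
    intro ξ η ζ ζ'
    rw [coe_comp, Function.comp_apply, adjoint_inner_right]
    rfl
  ext T
  constructor
  · rintro ⟨ξ, η, h⟩
    refine ⟨(ξ, η), ?_⟩
    ext ζ'
    apply ext_inner_left ℂ
    intro ζ
    rw [h, key]
  · rintro ⟨⟨ξ, η⟩, rfl⟩
    exact ⟨ξ, η, key ξ η⟩

lemma hatA_eq (X : H2 →L[ℂ] H2) :
    hatA t2 X = (adj (rM t2) ⋆⋆ sing X ⋆⋆ rM t2 : Submodule ℂ (H →L[ℂ] H)) := by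
  rw [hatA, slicesR_eq, adj_rM, rM, cl_range_triple, coe_cl]

lemma tensorOp_iff (a b : H →L[ℂ] H) (T : H2 →L[ℂ] H2) :
    IsTensorOp t2 t2 a b T ↔ T = amp t2 t2 b ∘L amp t2.flip t2.flip a := by
  have key : ∀ x y, (amp t2 t2 b ∘L amp t2.flip t2.flip a) (t2.tmul x y) =
      t2.tmul (a x) (b y) := by
    intro x y
    have h1 : amp t2.flip t2.flip a (t2.tmul x y) = t2.tmul (a x) y :=
      amp_tmul t2.flip t2.flip a y x
    rw [coe_comp, Function.comp_apply, h1, amp_tmul]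
  constructor
  · intro h
    apply t2.ext_clm
    intro x y
    apply t2.ext_vec
    intro x' y'
    rw [h, key, t2.inner_tmul]
  · rintro rfl ζ ξ ζ' η
    rw [key, t2.inner_tmul]

lemma cl_rankOne_eq : ((cl (Set.range fun p : H × H => InnerProductSpace.rankOne ℂ p.1 p.2) :
    Submodule ℂ (H →L[ℂ] H)) : Set (H →L[ℂ] H)) = {T : H →L[ℂ] H | IsCompactOperator T} := by
  apply Set.Subset.antisymm
  · have : cl (Set.range fun p : H × H => InnerProductSpace.rankOne ℂ p.1 p.2) ≤
        compactOperator (RingHom.id ℂ) H H := by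
      apply cl_le
      · exact isClosed_setOfPred_isCompactOperator
      · rintro _ ⟨⟨x, y⟩, rfl⟩
        have h : IsCompactOperator (innerSL ℂ y) :=
          isCompactOperator_of_locallyCompactSpace_dom (innerSL ℂ y)
        have h' := h.clm_comp (toSpanSingleton ℂ x)
        exact h'
    exact this
  · intro T hT
    exact compact_mem_cl T hT

lemma flip_rM {Sg : H2 →L[ℂ] H2} (hSg : ∀ a b : H, Sg (t2.tmul a b) = t2.tmul b a) :
    sing Sg ⋆⋆ rM t2 = lM t2 := by
  rw [rM, sing_mul_range, lM]
  congr 2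
  funext ξ
  ext x
  exact hSg x ξ

lemma flip_adj {Sg : H2 →L[ℂ] H2} (hSg : ∀ a b : H, Sg (t2.tmul a b) = t2.tmul b a) :
    adjoint Sg = Sg := by
  apply t2.ext_clm
  intro a b
  apply t2.ext_vec
  intro c d
  rw [adjoint_inner_right, hSg, hSg, t2.inner_tmul, t2.inner_tmul, mul_comm]

lemma rM_flip {Sg : H2 →L[ℂ] H2} (hSg : ∀ a b : H, Sg (t2.tmul a b) = t2.tmul b a) :
    adj (rM t2) ⋆⋆ sing Sg = adj (lM t2) := by
  rw [← flip_rM t2 hSg, adj_mul, adj_sing, flip_adj t2 hSg]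

end Part4

lemma ra' {E F G K : Type*}
    [NormedAddCommGroup E] [InnerProductSpace ℂ E]
    [NormedAddCommGroup F] [InnerProductSpace ℂ F]
    [NormedAddCommGroup G] [InnerProductSpace ℂ G]
    [NormedAddCommGroup K] [InnerProductSpace ℂ K]
    {P : Submodule ℂ (G →L[ℂ] K)} {Q : Submodule ℂ (F →L[ℂ] G)} {Z : Submodule ℂ (F →L[ℂ] K)}
    (h : P ⋆⋆ Q = Z) (X : Submodule ℂ (E →L[ℂ] F)) : P ⋆⋆ Q ⋆⋆ X = Z ⋆⋆ X := by
  rw [← h, mulM_assoc]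

/-- For a regular multiplicative unitary `W` on `H` and `Ŵ := ΣW*Σ`,
`[(a ⊗ 1)·W·(1 ⊗ b) : a ∈ Â(W), b ∈ Â(Ŵ)] = Â(W) ⊗min Â(Ŵ)`. -/
theorem statement9
    {H H2 H3 : Type*}
    [NormedAddCommGroup H] [InnerProductSpace ℂ H] [CompleteSpace H]
    [NormedAddCommGroup H2] [InnerProductSpace ℂ H2] [CompleteSpace H2]
    [NormedAddCommGroup H3] [InnerProductSpace ℂ H3] [CompleteSpace H3]
    -- realizations of the tensor products H ⊗ H and H ⊗ H ⊗ H
    (t2 : TensorPair H H H2) (t3 : TensorTriple H H H H3)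
    -- W is a unitary on H ⊗ H
    (W : H2 →L[ℂ] H2) (hWu : star W * W = 1 ∧ W * star W = 1)
    -- the legs W₁₂, W₂₃, W₁₃ of W on H ⊗ H ⊗ H
    (W12 W23 W13 : H3 →L[ℂ] H3)
    (hW12 : IsLeg12 t2 t3 W W12) (hW23 : IsLeg23 t2 t3 W W23)
    (hW13 : IsLeg13 t2 t3 W W13)
    -- the pentagon equation W₂₃W₁₂ = W₁₂W₁₃W₂₃
    (hpent : W23 * W12 = W12 * W13 * W23)
    -- the tensor flip Σ on H ⊗ H
    (Sg : H2 →L[ℂ] H2) (hSg : ∀ a b : H, Sg (t2.tmul a b) = t2.tmul b a)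
    -- regularity: C(W) = K(H)
    (hreg : hatA t2 (Sg * W) = {T : H →L[ℂ] H | IsCompactOperator T}) :
    cspan {y : H2 →L[ℂ] H2 | ∃ a ∈ hatA t2 W, ∃ b ∈ hatA t2 (Sg * star W * Sg),
        ∃ Ta Tb : H2 →L[ℂ] H2, IsTensorOp t2 t2 a 1 Ta ∧ IsTensorOp t2 t2 1 b Tb ∧
          y = Ta * W * Tb}
      = minTensor t2 (hatA t2 W) (hatA t2 (Sg * star W * Sg)) := by
  have hB : hatA t2 (Sg * star W * Sg) =
      (adj (lM t2) ⋆⋆ sing (adjoint W) ⋆⋆ lM t2 : Submodule ℂ (H →L[ℂ] H)) := by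
    rw [hatA_eq]
    have : sing (Sg * star W * Sg) = sing Sg ⋆⋆ sing (adjoint W) ⋆⋆ sing Sg := by
      simp only [sing_mul_sing]; rfl
    rw [this]
    simp only [mulM_assoc]
    rw [flip_rM t2 hSg, ra' (rM_flip t2 hSg)]
  have hreg' : adj (lM t2) ⋆⋆ sing W ⋆⋆ rM t2 =
      cl (Set.range fun p : H × H => InnerProductSpace.rankOne ℂ p.1 p.2) := by
    apply SetLike.coe_injective
    rw [cl_rankOne_eq, ← hreg, hatA_eq]
    have : sing (Sg * W) = sing Sg ⋆⋆ sing W := by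
      simp only [sing_mul_sing]; rfl
    rw [this]
    simp only [mulM_assoc]
    rw [ra' (rM_flip t2 hSg)]
  have main := main_core t2 t3 W hWu W12 W23 W13 hW12 hW23 hW13 hpent hreg'
  rw [hB, hatA_eq, minTensor]
  set A := adj (lM t2) ⋆⋆ sing (adjoint W) ⋆⋆ lM t2
  set B := adj (rM t2) ⋆⋆ sing W ⋆⋆ rM t2
  have h1 : ∀ a : H →L[ℂ] H, ∀ T, IsTensorOp t2 t2 a 1 T ↔
      T = TensorPair.amp t2.flip t2.flip a := by
    intro a T
    have : TensorPair.amp t2 t2 (1 : H →L[ℂ] H) = .id ℂ H2 := TensorPair.amp_id t2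
    rw [tensorOp_iff, this, ContinuousLinearMap.id_comp]
  have h2 : ∀ b : H →L[ℂ] H, ∀ T, IsTensorOp t2 t2 1 b T ↔
      T = TensorPair.amp t2 t2 b := by
    intro a T
    have : TensorPair.amp t2.flip t2.flip (1 : H →L[ℂ] H) = .id ℂ H2 :=
      TensorPair.amp_id t2.flip
    rw [tensorOp_iff, this, ContinuousLinearMap.comp_id]
  rw [mapM, mapM, sing_mul_cl, cl_mul_cl, cl_mul_cl] at main
  have main' := congrArg (fun P : Submodule ℂ (H2 →L[ℂ] H2) => (P : Set (H2 →L[ℂ] H2))) main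
  simp only [coe_cl] at main'
  have e1 : {y : H2 →L[ℂ] H2 | ∃ a ∈ (B : Set (H →L[ℂ] H)), ∃ b ∈ (A : Set (H →L[ℂ] H)),
      ∃ Ta Tb : H2 →L[ℂ] H2, IsTensorOp t2 t2 a 1 Ta ∧ IsTensorOp t2 t2 1 b Tb ∧
        y = Ta * W * Tb} = pr (TensorPair.amp t2.flip t2.flip '' (B : Set (H →L[ℂ] H)))
          ((fun t => W ∘L t) '' (TensorPair.amp t2 t2 '' (A : Set (H →L[ℂ] H)))) := by
    ext y
    constructor
    · rintro ⟨a, ha, b, hb, Ta, Tb, hTa, hTb, rfl⟩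
      rw [h1] at hTa
      rw [h2] at hTb
      subst hTa hTb
      exact ⟨_, ⟨a, ha, rfl⟩, _, ⟨_, ⟨b, hb, rfl⟩, rfl⟩, rfl⟩
    · rintro ⟨_, ⟨a, ha, rfl⟩, _, ⟨_, ⟨b, hb, rfl⟩, rfl⟩, rfl⟩
      exact ⟨a, ha, b, hb, _, _, (h1 _ _).2 rfl, (h2 _ _).2 rfl, rfl⟩
  have e2 : {T : H2 →L[ℂ] H2 | ∃ a ∈ (B : Set (H →L[ℂ] H)), ∃ b ∈ (A : Set (H →L[ℂ] H)),
      IsTensorOp t2 t2 a b T} = pr (TensorPair.amp t2 t2 '' (A : Set (H →L[ℂ] H)))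
        (TensorPair.amp t2.flip t2.flip '' (B : Set (H →L[ℂ] H))) := by
    ext y
    constructor
    · rintro ⟨a, ha, b, hb, h⟩
      rw [tensorOp_iff] at h
      exact ⟨_, ⟨b, hb, rfl⟩, _, ⟨a, ha, rfl⟩, h.symm⟩
    · rintro ⟨_, ⟨b, hb, rfl⟩, _, ⟨a, ha, rfl⟩, rfl⟩
      exact ⟨a, ha, b, hb, (tensorOp_iff t2 a b _).2 rfl⟩
  rw [e1, e2]
  exact main'

end
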